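/- Let 0 ≤ l ≤ n be integers and let f₁, …, f_n be 2π-periodic functions, each with absolutely convergent Fourier series and with Σ_k e^{ν|k|t}|k|^{2}|f̂_j(k)| < ∞ for every j. Define I(α) = pv ∫_𝕋 Π_{j=1}^{l} f_j(α−β) · Π_{j=l+1}^{n} Δ_βf_j(α) · dβ/(2 sin(β/2)) and J(α) = pv ∫_𝕋 Π_{j=1}^{l} f_j(α−β) · Π_{j=l+1}^{n} Δ_βf_j(α) · dβ/(2 tan(β/2)). Then for every 0 < s ≤ 1, ‖I‖_{Ḟ^{s,1}_ν} and ‖J‖_{Ḟ^{s,1}_ν} are both bounded by 4 [ Σ_{i=1}^{l} ‖f_i‖_{Ḟ^{s,1}_ν} Π_{j≤l, j≠i} ‖f_j‖_{F^{0,1}_ν} Π_{j=l+1}^{n} ‖f_j‖_{Ḟ^{1,1}_ν} + Σ_{i=l+1}^{n} ‖f_i‖_{Ḟ^{s+1,1}_ν} Π_{j=1}^{l} ‖f_j‖_{F^{0,1}_ν} Π_{j>l, j≠i} ‖f_j‖_{Ḟ^{1,1}_ν} ], and for s = 0, ‖I‖_{F^{0,1}_ν} and ‖J‖_{F^{0,1}_ν}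 are bounded by 4 Π_{j=1}^{l} ‖f_j‖_{F^{0,1}_ν} Π_{j=l+1}^{n} ‖f_j‖_{Ḟ^{1,1}_ν}. -/

import Mathlib

open MeasureTheory Filter

/-- The `k`-th Fourier coefficient of a `2π`-periodic function `f : ℝ → ℂ`. -/
noncomputable def cFourierCoef (f : ℝ → ℂ) (k : ℤ) : ℂ :=
  (1 / (2 * Real.pi)) * ∫ α in (-Real.pi)..Real.pi, f α * Complex.exp (-Complex.I * k * α)

/-- The homogeneous analytic Wiener seminorm `‖f‖_{Ḟ^{s,1}_ν}` at time `t`. -/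
noncomputable def cWienerNorm (ν t s : ℝ) (f : ℝ → ℂ) : ENNReal :=
  ∑' k : ℤ, if k = 0 then 0 else
    ENNReal.ofReal (Real.exp (ν * |(k : ℝ)| * t) * |(k : ℝ)| ^ s *
      ‖cFourierCoef f k‖)

/-- The nonhomogeneous analytic Wiener norm `‖f‖_{F^{s,1}_ν}` at time `t`. -/
noncomputable def cWienerNormF (ν t s : ℝ) (f : ℝ → ℂ) : ENNReal :=
  ENNReal.ofReal ‖cFourierCoef f 0‖ + cWienerNorm ν t s f

/-- The finite difference quotient `Δ_β f(α) = (f(α-β) - f(α))/(2 sin(β/2))`. -/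
noncomputable def deltaBeta (f : ℝ → ℂ) (β α : ℝ) : ℂ :=
  (f (α - β) - f α) / ((2 * Real.sin (β / 2) : ℝ) : ℂ)

/-- The product `Π_{j=1}^l f_j(α-β) · Π_{j=l+1}^n Δ_β f_j(α)`. -/
noncomputable def prodKer (n l : ℕ) (f : Fin n → ℝ → ℂ) (α β : ℝ) : ℂ :=
  ∏ j : Fin n, if (j : ℕ) < l then f j (α - β) else deltaBeta (f j) β α

/-- Truncated version of `pv ∫_𝕋 prodKer · dβ/(2 sin(β/2))`. -/
noncomputable def pvSinApprox (n l : ℕ) (f : Fin n → ℝ → ℂ) (α ε : ℝ) : ℂ :=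
  (∫ β in ε..Real.pi, prodKer n l f α β / ((2 * Real.sin (β / 2) : ℝ) : ℂ)) +
    ∫ β in (-Real.pi)..(-ε), prodKer n l f α β / ((2 * Real.sin (β / 2) : ℝ) : ℂ)

/-- Truncated version of `pv ∫_𝕋 prodKer · dβ/(2 tan(β/2))`. -/
noncomputable def pvTanApprox (n l : ℕ) (f : Fin n → ℝ → ℂ) (α ε : ℝ) : ℂ :=
  (∫ β in ε..Real.pi, prodKer n l f α β / ((2 * Real.tan (β / 2) : ℝ) : ℂ)) +
    ∫ β in (-Real.pi)..(-ε), prodKer n l f α β / ((2 * Real.tan (β / 2) : ℝ) : ℂ)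

/-- The right-hand side of the nonlinear estimate for `0 < s ≤ 1`. -/
noncomputable def nonlinearRHS (n l : ℕ) (f : Fin n → ℝ → ℂ) (ν t s : ℝ) : ENNReal :=
  ENNReal.ofReal 4 *
    ((∑ i ∈ Finset.univ.filter (fun j : Fin n => (j : ℕ) < l),
        cWienerNorm ν t s (f i) *
          (∏ j ∈ Finset.univ.filter (fun j : Fin n => (j : ℕ) < l ∧ j ≠ i),
            cWienerNormF ν t 0 (f j)) *
          ∏ j ∈ Finset.univ.filter (fun j : Fin n => ¬ (j : ℕ) < l),
            cWienerNorm ν t 1 (f j)) +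
      ∑ i ∈ Finset.univ.filter (fun j : Fin n => ¬ (j : ℕ) < l),
        cWienerNorm ν t (s + 1) (f i) *
          (∏ j ∈ Finset.univ.filter (fun j : Fin n => (j : ℕ) < l),
            cWienerNormF ν t 0 (f j)) *
          ∏ j ∈ Finset.univ.filter (fun j : Fin n => ¬ (j : ℕ) < l ∧ j ≠ i),
            cWienerNorm ν t 1 (f j))

/-- The right-hand side of the nonlinear estimate for `s = 0`. -/
noncomputable def nonlinearRHS0 (n l : ℕ) (f : Fin n → ℝ → ℂ) (ν t : ℝ) : ENNReal :=
  ENNReal.ofReal 4 *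
    ((∏ j ∈ Finset.univ.filter (fun j : Fin n => (j : ℕ) < l), cWienerNormF ν t 0 (f j)) *
      ∏ j ∈ Finset.univ.filter (fun j : Fin n => ¬ (j : ℕ) < l), cWienerNorm ν t 1 (f j))


open Polynomial.Chebyshev in
/-- The function `sin (q β / 2) / sin (β / 2)`, as a Chebyshev polynomial in `cos (β / 2)`. -/
noncomputable def sinRatio (q : ℤ) (β : ℝ) : ℝ := (U ℝ (q - 1)).eval (Real.cos (β / 2))

lemma continuous_sinRatio (q : ℤ) : Continuous (sinRatio q) := by
  unfold sinRatio
  exact (Polynomial.continuous _).comp (by fun_prop)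

lemma sinRatio_mul_sin (q : ℤ) (β : ℝ) :
    sinRatio q β * Real.sin (β / 2) = Real.sin (q * β / 2) := by
  unfold sinRatio
  rw [Polynomial.Chebyshev.U_real_cos]
  congr 1
  push_cast
  ring

lemma sinRatio_zero (β : ℝ) : sinRatio 0 β = 0 := by
  simp [sinRatio]

lemma sinRatio_one (β : ℝ) : sinRatio 1 β = 1 := by
  simp [sinRatio]

lemma sinRatio_neg (q : ℤ) (β : ℝ) : sinRatio (-q) β = -sinRatio q β := by
  simp [sinRatio, Polynomial.Chebyshev.U_neg_sub_one]

lemma sinRatio_add_two (q : ℤ) (β : ℝ) :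
    sinRatio (q + 2) β = sinRatio q β + 2 * Real.cos ((q + 1) * β / 2) := by
  unfold sinRatio
  have h := Polynomial.Chebyshev.U_eq_two_mul_T_add_U ℝ (q - 1)
  rw [show q + 2 - 1 = q - 1 + 2 by ring, h, Polynomial.eval_add, Polynomial.eval_mul,
    Polynomial.Chebyshev.T_real_cos, add_comm]
  congr 2
  · simp
  · congr 1
    push_cast
    ring

lemma abs_sinRatio_natCast_le (β : ℝ) (m : ℕ) : |sinRatio m β| ≤ m := by
  induction m using Nat.twoStepInduction with
  | zero => simp [sinRatio_zero]
  | one => simp [sinRatio_one]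
  | more m ih _ =>
    have h := sinRatio_add_two m β
    push_cast at h ⊢
    rw [h]
    refine (abs_add_le _ _).trans (add_le_add ih ?_)
    rw [abs_mul, abs_two]
    linarith [Real.abs_cos_le_one ((m + 1) * β / 2)]

lemma abs_sinRatio_le (q : ℤ) (β : ℝ) : |sinRatio q β| ≤ |(q : ℝ)| := by
  obtain ⟨m, rfl | rfl⟩ := q.eq_nat_or_neg
  · simpa using abs_sinRatio_natCast_le β m
  · simpa [sinRatio_neg] using abs_sinRatio_natCast_le β m

lemma integral_sinRatio_add_two (m : ℕ) :
    ∫ β in (0 : ℝ)..Real.pi, sinRatio ((m : ℤ) + 2) β =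
      (∫ β in (0 : ℝ)..Real.pi, sinRatio m β) +
        4 / (m + 1) * Real.sin ((m + 1) * Real.pi / 2) := by
  simp_rw [sinRatio_add_two]
  rw [intervalIntegral.integral_add ((continuous_sinRatio _).intervalIntegrable _ _)
    (Continuous.intervalIntegrable (by fun_prop) _ _)]
  congr 1
  have hm : ((m : ℝ) + 1) / 2 ≠ 0 := by positivity
  have h := intervalIntegral.integral_comp_mul_left (a := 0) (b := Real.pi) Real.cos hm
  rw [integral_cos] at h
  rw [intervalIntegral.integral_const_mul]
  have h' : ∀ β : ℝ, ((m : ℤ) + 1 : ℝ) * β / 2 = ((m : ℝ) + 1) / 2 * β := by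
    intro β; push_cast; ring
  simp_rw [h', h]
  simp only [mul_zero, Real.sin_zero, sub_zero, smul_eq_mul]
  rw [show ((m : ℝ) + 1) / 2 * Real.pi = (m + 1) * Real.pi / 2 by ring]
  field_simp
  ring

lemma integral_sinRatio_odd (m : ℕ) :
    ∫ β in (0 : ℝ)..Real.pi, sinRatio ((2 * m + 1 : ℕ) : ℤ) β = Real.pi := by
  induction m with
  | zero => simp [sinRatio_one]
  | succ m ih =>
    have h := integral_sinRatio_add_two (2 * m + 1)
    rw [ih] at h
    rw [show ((2 * (m + 1) + 1 : ℕ) : ℤ) = ((2 * m + 1 : ℕ) : ℤ) + 2 by push_cast; ring, h]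
    rw [show (((2 * m + 1 : ℕ) : ℝ) + 1) * Real.pi / 2 = ((m + 1 : ℕ) : ℝ) * Real.pi by
      push_cast; ring, Real.sin_nat_mul_pi]
    simp

lemma integral_sinRatio_even_step (m : ℕ) :
    ∫ β in (0 : ℝ)..Real.pi, sinRatio ((2 * (m + 1) : ℕ) : ℤ) β =
      (∫ β in (0 : ℝ)..Real.pi, sinRatio ((2 * m : ℕ) : ℤ) β) +
        4 / (2 * m + 1) * (-1) ^ m := by
  have h := integral_sinRatio_add_two (2 * m)
  rw [show ((2 * (m + 1) : ℕ) : ℤ) = ((2 * m : ℕ) : ℤ) + 2 by push_cast; ring, h]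
  rw [show (((2 * m : ℕ) : ℝ) + 1) * Real.pi / 2 = (m : ℝ) * Real.pi + Real.pi / 2 by
    push_cast; ring, Real.sin_add_pi_div_two, Real.cos_nat_mul_pi]
  push_cast
  rfl

lemma integral_sinRatio_four_mul (m : ℕ) :
    0 ≤ (∫ β in (0 : ℝ)..Real.pi, sinRatio ((2 * (2 * m) : ℕ) : ℤ) β) ∧
      (∫ β in (0 : ℝ)..Real.pi, sinRatio ((2 * (2 * m) : ℕ) : ℤ) β) + 4 / (4 * m + 1) ≤ 4 := by
  induction m with
  | zero => simp [sinRatio_zero]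
  | succ m ih =>
    have h1 := integral_sinRatio_even_step (2 * m)
    have h2 := integral_sinRatio_even_step (2 * m + 1)
    rw [show 2 * (m + 1) = 2 * m + 1 + 1 by ring, h2, h1]
    push_cast
    rw [pow_succ, pow_mul]
    norm_num
    rw [show (2 : ℝ) * (2 * m) + 1 = 4 * m + 1 by ring,
      show (2 : ℝ) * (2 * m + 1) + 1 = 4 * m + 3 by ring,
      show (4 : ℝ) * (m + 1) + 1 = 4 * m + 5 by ring]
    have a : (4 : ℝ) / (4 * m + 3) ≤ 4 / (4 * m + 1) := by gcongr; norm_num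
    have b : (4 : ℝ) / (4 * m + 5) ≤ 4 / (4 * m + 3) := by gcongr; norm_num
    push_cast at ih
    constructor <;> linarith [ih.1, ih.2]

lemma abs_integral_sinRatio_natCast_le (m : ℕ) :
    |∫ β in (0 : ℝ)..Real.pi, sinRatio m β| ≤ 4 := by
  obtain ⟨k, rfl | rfl⟩ := m.even_or_odd'
  · obtain ⟨j, rfl | rfl⟩ := k.even_or_odd'
    · have h := integral_sinRatio_four_mul j
      have : (0 : ℝ) ≤ 4 / (4 * j + 1) := by positivity
      rw [abs_le]
      constructor <;> linarith [h.1, h.2]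
    · have h := integral_sinRatio_four_mul j
      have : (0 : ℝ) ≤ 4 / (4 * j + 1) := by positivity
      rw [integral_sinRatio_even_step (2 * j), pow_mul]
      push_cast at h ⊢
      norm_num at h ⊢
      rw [show (2 : ℝ) * (2 * j) + 1 = 4 * j + 1 by ring]
      rw [abs_le]
      constructor <;> linarith [h.1, h.2]
  · rw [integral_sinRatio_odd, abs_of_pos Real.pi_pos]
    exact Real.pi_le_four

lemma abs_integral_sinRatio_le (q : ℤ) : |∫ β in (0 : ℝ)..Real.pi, sinRatio q β| ≤ 4 := by
  obtain ⟨m, rfl | rfl⟩ := q.eq_nat_or_neg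
  · exact abs_integral_sinRatio_natCast_le m
  · simpa [sinRatio_neg] using abs_integral_sinRatio_natCast_le m

/-- The half-frequency exponential `e^{i q β / 2}`. -/
noncomputable def halfExp (q : ℤ) (β : ℝ) : ℂ := Complex.exp (Complex.I * (q * β / 2))

lemma continuous_halfExp (q : ℤ) : Continuous (halfExp q) := by
  unfold halfExp; fun_prop

lemma halfExp_add (p q : ℤ) (β : ℝ) : halfExp (p + q) β = halfExp p β * halfExp q β := by
  unfold halfExp
  rw [← Complex.exp_add]
  congr 1
  push_cast
  ring

lemma norm_halfExp (q : ℤ) (β : ℝ) : ‖halfExp q β‖ = 1 := by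
  unfold halfExp
  rw [Complex.norm_exp]
  simp

lemma halfExp_sub_halfExp_neg (q : ℤ) (β : ℝ) :
    halfExp q β - halfExp q (-β) = 2 * Complex.I * (Real.sin (q * β / 2) : ℝ) := by
  have h := Complex.two_sin (q * β / 2 : ℂ)
  have e1 : Complex.I * ((q : ℂ) * ((-β : ℝ) : ℂ) / 2) = -(q * β / 2 : ℂ) * Complex.I := by
    push_cast; ring
  have e2 : Complex.I * ((q : ℂ) * (β : ℂ) / 2) = (q * β / 2 : ℂ) * Complex.I := by ring
  unfold halfExp
  rw [e1, e2]
  push_cast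
  rw [show 2 * Complex.I * Complex.sin (q * β / 2 : ℂ) =
    (2 * Complex.sin (q * β / 2 : ℂ)) * Complex.I by ring, h]
  ring_nf
  simp
  ring

/-- The arc `(-π, π]` with a neighbourhood of the origin of radius `ε` removed. -/
def puncturedArc (ε : ℝ) : Set ℝ := Set.Ioc (-Real.pi) (-ε) ∪ Set.Ioc ε Real.pi

lemma measurableSet_puncturedArc (ε : ℝ) : MeasurableSet (puncturedArc ε) :=
  measurableSet_Ioc.union measurableSet_Ioc

lemma sin_half_ne_zero {β : ℝ} (h0 : β ≠ 0) (h1 : -Real.pi ≤ β) (h2 : β ≤ Real.pi) :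
    Real.sin (β / 2) ≠ 0 := by
  have hp := Real.pi_pos
  rcases lt_or_gt_of_ne h0 with h | h
  · exact (Real.sin_neg_of_neg_of_neg_pi_lt (by linarith) (by linarith)).ne
  · exact (Real.sin_pos_of_pos_of_lt_pi (by linarith) (by linarith)).ne'

lemma sin_half_ne_zero_of_mem {ε β : ℝ} (hε : 0 < ε) (h : β ∈ puncturedArc ε) :
    Real.sin (β / 2) ≠ 0 := by
  have hp := Real.pi_pos
  rcases h with ⟨h1, h2⟩ | ⟨h1, h2⟩ <;> apply sin_half_ne_zero <;> linarith

lemma integrableOn_puncturedArc {ε : ℝ} (hε : 0 < ε) {g : ℝ → ℂ}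
    (hg : ContinuousOn g {β | Real.sin (β / 2) ≠ 0}) : IntegrableOn g (puncturedArc ε) := by
  have hp := Real.pi_pos
  refine IntegrableOn.union ?_ ?_
  · refine (ContinuousOn.integrableOn_Icc (hg.mono fun β hβ => ?_)).mono_set Set.Ioc_subset_Icc_self
    exact sin_half_ne_zero (by linarith [hβ.2] : β < 0).ne hβ.1 (by linarith [hβ.2])
  · refine (ContinuousOn.integrableOn_Icc (hg.mono fun β hβ => ?_)).mono_set Set.Ioc_subset_Icc_self
    exact sin_half_ne_zero (by linarith [hβ.1] : 0 < β).ne' (by linarith [hβ.1]) hβ.2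

lemma setIntegral_puncturedArc {ε : ℝ} (hε : 0 < ε) (hεπ : ε ≤ Real.pi) {g : ℝ → ℂ}
    (hg : ContinuousOn g {β | Real.sin (β / 2) ≠ 0}) :
    ∫ β in puncturedArc ε, g β =
      (∫ β in ε..Real.pi, g β) + ∫ β in (-Real.pi)..(-ε), g β := by
  have hi := integrableOn_puncturedArc hε hg
  unfold puncturedArc at hi ⊢
  rw [setIntegral_union _ measurableSet_Ioc hi.left_of_union hi.right_of_union,
    intervalIntegral.integral_of_le hεπ, intervalIntegral.integral_of_le (by linarith), add_comm]
  rw [Set.disjoint_left]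
  rintro β ⟨_, h⟩ ⟨h', _⟩
  linarith

lemma continuousOn_div_sin {g : ℝ → ℂ} (hg : ContinuousOn g {β | Real.sin (β / 2) ≠ 0}) :
    ContinuousOn (fun β => g β / ((2 * Real.sin (β / 2) : ℝ) : ℂ))
      {β | Real.sin (β / 2) ≠ 0} := by
  refine hg.div (by fun_prop) fun β hβ => ?_
  exact_mod_cast mul_ne_zero two_ne_zero hβ

lemma setIntegral_halfExp_div_sin (q : ℤ) {ε : ℝ} (hε : 0 < ε) (hεπ : ε ≤ Real.pi) :
    ∫ β in puncturedArc ε, halfExp q β / ((2 * Real.sin (β / 2) : ℝ) : ℂ) =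
      Complex.I * ((∫ β in ε..Real.pi, sinRatio q β : ℝ) : ℂ) := by
  have hc := continuousOn_div_sin (continuous_halfExp q).continuousOn
  rw [setIntegral_puncturedArc hε hεπ hc,
    ← intervalIntegral.integral_comp_neg, ← intervalIntegral.integral_ofReal,
    ← intervalIntegral.integral_const_mul, ← intervalIntegral.integral_add]
  · refine intervalIntegral.integral_congr fun β hβ => ?_
    rw [Set.uIcc_of_le hεπ] at hβ
    have hs := sin_half_ne_zero (by linarith [hβ.1] : 0 < β).ne'
      (by linarith [hβ.1, Real.pi_pos]) hβ.2
    have h1 := halfExp_sub_halfExp_neg q β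
    rw [← sinRatio_mul_sin] at h1
    have hs' : (Real.sin (β / 2) : ℂ) ≠ 0 := by exact_mod_cast hs
    have hn : Real.sin (-β / 2) = -Real.sin (β / 2) := by rw [neg_div, Real.sin_neg]
    simp only [hn]
    push_cast [-Complex.ofReal_sin] at h1 ⊢
    field_simp
    linear_combination h1
  · refine ContinuousOn.intervalIntegrable (hc.mono fun β hβ => ?_)
    rw [Set.uIcc_of_le hεπ] at hβ
    exact sin_half_ne_zero (by linarith [hβ.1] : 0 < β).ne'
      (by linarith [hβ.1, Real.pi_pos]) hβ.2
  · refine ContinuousOn.intervalIntegrable ((hc.comp continuous_neg.continuousOn fun β hβ => ?_))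
    rw [Set.uIcc_of_le hεπ] at hβ
    exact sin_half_ne_zero (neg_ne_zero.2 (by linarith [hβ.1] : 0 < β).ne')
      (by linarith [hβ.2]) (by linarith [hβ.1, Real.pi_pos])

/-- The integral of `g(β) / (2 sin (β/2))` over the punctured arc of radius `ε`. -/
noncomputable def arcIntegral (g : ℝ → ℂ) (ε : ℝ) : ℂ :=
  ∫ β in puncturedArc ε, g β / ((2 * Real.sin (β / 2) : ℝ) : ℂ)

/-- The truncated integrals of `g(β) / (2 sin (β/2))` are bounded by `B`, and they converge to a
principal value of norm at most `L`. -/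
structure HasPVBound (g : ℝ → ℂ) (B L : ℝ) : Prop where
  continuousOn : ContinuousOn g {β | Real.sin (β / 2) ≠ 0}
  norm_le : ∀ ε, 0 < ε → ε ≤ Real.pi → ‖arcIntegral g ε‖ ≤ B
  exists_lim : ∃ z : ℂ, ‖z‖ ≤ L ∧ Tendsto (arcIntegral g) (nhdsWithin 0 (Set.Ioi 0)) (nhds z)

lemma arcIntegral_congr {g h : ℝ → ℂ} (hgh : ∀ β, Real.sin (β / 2) ≠ 0 → g β = h β) {ε : ℝ}
    (hε : 0 < ε) : arcIntegral g ε = arcIntegral h ε := by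
  refine setIntegral_congr_fun (measurableSet_puncturedArc ε) fun β hβ => ?_
  simp only [hgh β (sin_half_ne_zero_of_mem hε hβ)]

lemma HasPVBound.congr {g h : ℝ → ℂ} {B L : ℝ} (hg : HasPVBound g B L)
    (hgh : ∀ β, Real.sin (β / 2) ≠ 0 → h β = g β) : HasPVBound h B L where
  continuousOn := hg.continuousOn.congr fun β hβ => hgh β hβ
  norm_le ε hε hεπ := by
    rw [arcIntegral_congr hgh hε]
    exact hg.norm_le ε hε hεπ
  exists_lim := by
    obtain ⟨z, hz, hl⟩ := hg.exists_lim
    refine ⟨z, hz, hl.congr' ?_⟩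
    filter_upwards [self_mem_nhdsWithin] with ε hε
    exact (arcIntegral_congr hgh hε).symm

lemma HasPVBound.mono {g : ℝ → ℂ} {B L B' : ℝ} (hg : HasPVBound g B L) (hB : B ≤ B') :
    HasPVBound g B' L :=
  ⟨hg.continuousOn, fun ε h h' => (hg.norm_le ε h h').trans hB, hg.exists_lim⟩

lemma HasPVBound.const_mul {g : ℝ → ℂ} {B L : ℝ} (hg : HasPVBound g B L) (u : ℂ) :
    HasPVBound (fun β => u * g β) (‖u‖ * B) (‖u‖ * L) := by
  have h : ∀ ε, arcIntegral (fun β => u * g β) ε = u * arcIntegral g ε := by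
    intro ε
    unfold arcIntegral
    rw [← integral_const_mul]
    simp_rw [mul_div_assoc]
  refine ⟨continuousOn_const.mul hg.continuousOn, fun ε hε hεπ => ?_, ?_⟩
  · rw [h, norm_mul]
    exact mul_le_mul_of_nonneg_left (hg.norm_le ε hε hεπ) (norm_nonneg _)
  · obtain ⟨z, hz, hl⟩ := hg.exists_lim
    refine ⟨u * z, ?_, ?_⟩
    · rw [norm_mul]
      exact mul_le_mul_of_nonneg_left hz (norm_nonneg _)
    · rw [funext h]
      exact hl.const_mul u

lemma HasPVBound.sum {ι : Type*} (s : Finset ι) {g : ι → ℝ → ℂ} {B L : ℝ}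
    (hg : ∀ i ∈ s, HasPVBound (g i) B L) :
    HasPVBound (fun β => ∑ i ∈ s, g i β) (s.card * B) (s.card * L) := by
  have h : ∀ ε, 0 < ε → arcIntegral (fun β => ∑ i ∈ s, g i β) ε = ∑ i ∈ s, arcIntegral (g i) ε := by
    intro ε hε
    unfold arcIntegral
    simp_rw [Finset.sum_div]
    exact integral_finsetSum _ fun i hi =>
      integrableOn_puncturedArc hε (continuousOn_div_sin (hg i hi).continuousOn)
  refine ⟨continuousOn_finsetSum _ fun i hi => (hg i hi).continuousOn, fun ε hε hεπ => ?_, ?_⟩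
  · rw [h ε hε, ← nsmul_eq_mul]
    exact norm_sum_le_of_le _ (fun i hi => (hg i hi).norm_le ε hε hεπ) |>.trans_eq (by simp)
  · choose! z hz hl using fun i hi => (hg i hi).exists_lim
    refine ⟨∑ i ∈ s, z i, ?_, ?_⟩
    · exact (norm_sum_le_of_le _ hz).trans_eq (by simp)
    · refine (tendsto_finsetSum s hl).congr' ?_
      filter_upwards [self_mem_nhdsWithin] with ε hε
      exact (h ε hε).symm

lemma hasPVBound_halfExp (q : ℤ) : HasPVBound (halfExp q) (Real.pi * |(q : ℝ)|) 4 := by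
  refine ⟨(continuous_halfExp q).continuousOn, fun ε hε hεπ => ?_,
    Complex.I * ((∫ β in (0 : ℝ)..Real.pi, sinRatio q β : ℝ) : ℂ), ?_, ?_⟩
  · unfold arcIntegral
    rw [setIntegral_halfExp_div_sin q hε hεπ, norm_mul, Complex.norm_I, one_mul, Complex.norm_real]
    refine (intervalIntegral.norm_integral_le_of_norm_le_const
      fun β _ => abs_sinRatio_le q β).trans ?_
    rw [mul_comm, abs_of_nonneg (by linarith)]
    exact mul_le_mul_of_nonneg_right (by linarith) (abs_nonneg _)
  · rw [norm_mul, Complex.norm_I, one_mul, Complex.norm_real]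
    exact abs_integral_sinRatio_le q
  · have hc : Continuous fun ε : ℝ => ∫ β in ε..Real.pi, sinRatio q β := by
      simp_rw [fun ε : ℝ => intervalIntegral.integral_symm (μ := volume) (f := sinRatio q) Real.pi ε]
      exact (intervalIntegral.continuous_primitive
        (fun a b => (continuous_sinRatio q).intervalIntegrable a b) _).neg
    have hl : Tendsto (fun ε : ℝ => Complex.I * ((∫ β in ε..Real.pi, sinRatio q β : ℝ) : ℂ))
        (nhdsWithin 0 (Set.Ioi 0))
        (nhds (Complex.I * ((∫ β in (0 : ℝ)..Real.pi, sinRatio q β : ℝ) : ℂ))) :=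
      ((continuous_const.mul (Complex.continuous_ofReal.comp hc)).tendsto 0).mono_left
        nhdsWithin_le_nhds
    refine hl.congr' ?_
    filter_upwards [Ioc_mem_nhdsGT Real.pi_pos] with ε hε
    exact (setIntegral_halfExp_div_sin q hε.1 hε.2).symm

lemma hasPVBound_halfExp_mul_one (q : ℤ) :
    HasPVBound (fun β => halfExp q β * 1) (Real.pi * (1 + |(q : ℝ)|)) 4 := by
  simp_rw [mul_one]
  exact (hasPVBound_halfExp q).mono (by nlinarith [Real.pi_pos])

lemma hasPVBound_halfExp_mul_cos (q : ℤ) :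
    HasPVBound (fun β => halfExp q β * (Real.cos (β / 2) : ℂ)) (Real.pi * (1 + |(q : ℝ)|)) 4 := by
  have hB : ∀ i ∈ (Finset.univ : Finset (Fin 2)),
      HasPVBound (halfExp (![q + 1, q - 1] i)) (Real.pi * (1 + |(q : ℝ)|)) 4 := by
    intro i _
    refine (hasPVBound_halfExp _).mono (mul_le_mul_of_nonneg_left ?_ Real.pi_pos.le)
    fin_cases i
    · simpa [add_comm] using abs_add_le (q : ℝ) 1
    · simpa [add_comm] using abs_sub (q : ℝ) 1
  have h := ((HasPVBound.sum Finset.univ hB).const_mul (1 / 2))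
  norm_num at h
  refine (h.congr fun β _ => ?_).mono (by linarith)
  have hc := Complex.two_cos (β / 2 : ℂ)
  have e1 : halfExp 1 β = Complex.exp ((β / 2 : ℂ) * Complex.I) := by
    unfold halfExp; congr 1; push_cast; ring
  have e2 : halfExp (-1) β = Complex.exp (-(β / 2 : ℂ) * Complex.I) := by
    unfold halfExp; congr 1; push_cast; ring
  rw [sub_eq_add_neg, halfExp_add, halfExp_add, e1, e2]
  push_cast
  linear_combination (halfExp q β / 2) * hc

/-- `M` agrees with a unimodular multiple of a sum of `N` half-frequency exponentials with
frequencies at most `R`. -/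
def IsHalfTrigSum (N : ℕ) (R : ℝ) (M : ℝ → ℂ) : Prop :=
  ∃ (u : ℂ) (r : ℕ → ℤ), ‖u‖ = 1 ∧ (∀ p ∈ Finset.range N, |(r p : ℝ)| ≤ R) ∧
    ∀ β, Real.sin (β / 2) ≠ 0 → M β = u * ∑ p ∈ Finset.range N, halfExp (r p) β

lemma IsHalfTrigSum.norm_le {N : ℕ} {R : ℝ} {M : ℝ → ℂ} (hM : IsHalfTrigSum N R M) {β : ℝ}
    (hβ : Real.sin (β / 2) ≠ 0) : ‖M β‖ ≤ N := by
  obtain ⟨u, r, hu, -, h⟩ := hM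
  rw [h β hβ, norm_mul, hu, one_mul]
  exact (norm_sum_le_of_le _ fun p _ => (norm_halfExp _ β).le).trans_eq (by simp)

lemma HasPVBound.halfTrigSum_mul {N : ℕ} {R C L : ℝ} {M G : ℝ → ℂ} (hM : IsHalfTrigSum N R M)
    (hR : 0 ≤ R) (hC : 0 ≤ C)
    (hG : ∀ q : ℤ, HasPVBound (fun β => halfExp q β * G β) (C * (1 + |(q : ℝ)|)) L) (q : ℤ) :
    HasPVBound (fun β => halfExp q β * (M β * G β))
      ((N * (1 + R)) * C * (1 + |(q : ℝ)|)) (N * L) := by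
  obtain ⟨u, r, hu, hr, h⟩ := hM
  have hB : ∀ p ∈ Finset.range N, HasPVBound (fun β => halfExp (q + r p) β * G β)
      (C * ((1 + R) * (1 + |(q : ℝ)|))) L := by
    intro p hp
    refine (hG _).mono (mul_le_mul_of_nonneg_left ?_ hC)
    push_cast
    nlinarith [abs_add_le (q : ℝ) (r p), hr p hp, abs_nonneg (q : ℝ)]
  have h1 := (HasPVBound.sum _ hB).const_mul u
  rw [hu, one_mul, one_mul, Finset.card_range] at h1
  refine (h1.congr fun β hβ => ?_).mono (by ring_nf; rfl)
  rw [h β hβ, ← Finset.sum_mul]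
  simp_rw [halfExp_add, ← Finset.mul_sum]
  ring

lemma HasPVBound.halfTrigSum_prod_mul {ι : Type*} (s : Finset ι) {N : ι → ℕ} {R : ι → ℝ}
    {C L : ℝ} {M : ι → ℝ → ℂ} {G : ℝ → ℂ} (hM : ∀ i, IsHalfTrigSum (N i) (R i) (M i))
    (hR : ∀ i, 0 ≤ R i) (hC : 0 ≤ C)
    (hG : ∀ q : ℤ, HasPVBound (fun β => halfExp q β * G β) (C * (1 + |(q : ℝ)|)) L) (q : ℤ) :
    HasPVBound (fun β => halfExp q β * ((∏ i ∈ s, M i β) * G β))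
      ((∏ i ∈ s, (N i * (1 + R i))) * C * (1 + |(q : ℝ)|)) ((∏ i ∈ s, (N i : ℝ)) * L) := by
  classical
  induction s using Finset.induction_on generalizing q with
  | empty => simpa using hG q
  | insert i s hi ih =>
    have hC' : 0 ≤ (∏ i ∈ s, (N i * (1 + R i))) * C :=
      mul_nonneg (Finset.prod_nonneg fun j _ => mul_nonneg (Nat.cast_nonneg _)
        (by linarith [hR j])) hC
    have h := HasPVBound.halfTrigSum_mul (hM i) (hR i) hC' ih q
    simp_rw [Finset.prod_insert hi]
    simp only [mul_assoc] at h ⊢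
    exact h

lemma isHalfTrigSum_halfExp (q : ℤ) : IsHalfTrigSum 1 |(q : ℝ)| (halfExp q) :=
  ⟨1, fun _ => q, by simp, by simp, by simp⟩

lemma halfExp_mul_natCast (q : ℤ) (p : ℕ) (β : ℝ) : halfExp (q * p) β = halfExp q β ^ p := by
  unfold halfExp
  rw [← Complex.exp_nat_mul]
  congr 1
  push_cast
  ring

/-- The Fourier symbol of the difference quotient `f ↦ Δ_β f`. -/
noncomputable def diffSymbol (k : ℤ) (β : ℝ) : ℂ :=
  (halfExp (-2 * k) β - 1) / ((2 * Real.sin (β / 2) : ℝ) : ℂ)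

lemma isHalfTrigSum_diffSymbol_mul {σ : ℤ} (hσ : σ = 1 ∨ σ = -1) (m : ℕ) :
    IsHalfTrigSum m (2 * m) (diffSymbol (-σ * m)) := by
  refine ⟨σ * Complex.I, fun p => σ * (1 + 2 * p), ?_, fun p hp => ?_, fun β hβ => ?_⟩
  · rcases hσ with rfl | rfl <;> simp
  · have hp' : (p : ℝ) + 1 ≤ m := by exact_mod_cast Finset.mem_range.1 hp
    have : |(σ : ℝ)| = 1 := by rcases hσ with rfl | rfl <;> simp
    push_cast
    rw [abs_mul, this, one_mul, abs_of_nonneg (by positivity)]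
    linarith
  · have hs : (Real.sin (β / 2) : ℂ) ≠ 0 := by exact_mod_cast hβ
    have h1 := halfExp_sub_halfExp_neg 1 β
    have e : halfExp 1 (-β) = halfExp (-1) β := by simp [halfExp]
    have e' : halfExp 1 β * halfExp (-1) β = 1 := by rw [← halfExp_add]; simp [halfExp]
    rw [e] at h1
    have h2 : halfExp (2 * σ) β - 1 = σ * halfExp σ β * (2 * Complex.I * (Real.sin (β / 2) : ℝ)) := by
      rw [two_mul, halfExp_add]
      simp only [Int.cast_one, one_mul] at h1
      rcases hσ with rfl | rfl
      · push_cast at h1 ⊢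
        linear_combination halfExp 1 β * h1 + e'
      · push_cast at h1 ⊢
        linear_combination -halfExp (-1) β * h1 + e'
    have hsum : ∑ p ∈ Finset.range m, halfExp (σ * (1 + 2 * p)) β =
        halfExp σ β * ∑ p ∈ Finset.range m, halfExp (2 * σ) β ^ p := by
      rw [Finset.mul_sum]
      refine Finset.sum_congr rfl fun p _ => ?_
      rw [← halfExp_mul_natCast, ← halfExp_add]
      congr 1
      ring
    unfold diffSymbol
    rw [show -2 * (-σ * (m : ℤ)) = 2 * σ * m by ring, halfExp_mul_natCast, ← geom_sum_mul, h2, hsum]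
    push_cast [-Complex.ofReal_sin]
    field_simp

lemma isHalfTrigSum_diffSymbol (k : ℤ) :
    IsHalfTrigSum k.natAbs (2 * |(k : ℝ)|) (diffSymbol k) := by
  obtain ⟨m, rfl | rfl⟩ := k.eq_nat_or_neg
  · simpa using isHalfTrigSum_diffSymbol_mul (σ := -1) (Or.inr rfl) m
  · simpa using isHalfTrigSum_diffSymbol_mul (σ := 1) (Or.inl rfl) m

lemma Summable.prod_pi {𝕜 : Type*} [NormedField 𝕜] [CompleteSpace 𝕜] {n : ℕ}
    {g : Fin n → ℤ → 𝕜} (hg : ∀ j, Summable fun m => ‖g j m‖) :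
    (Summable fun k : Fin n → ℤ => ‖∏ j, g j (k j)‖) ∧
      HasSum (fun k : Fin n → ℤ => ∏ j, g j (k j)) (∏ j, ∑' m, g j m) := by
  induction n with
  | zero => exact ⟨Summable.of_finite, by simp⟩
  | succ n ih =>
    obtain ⟨h1, h2⟩ := ih fun j => hg j.succ
    have h3 := summable_mul_of_summable_norm (hg 0) h1
    have h4 := (hg 0).mul_norm h1
    rw [← (Fin.consEquiv fun _ => ℤ).summable_iff, ← (Fin.consEquiv fun _ => ℤ).hasSum_iff]
    simp only [Function.comp_def, Fin.consEquiv_apply, Fin.prod_univ_succ, Fin.cons_zero,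
      Fin.cons_succ]
    refine ⟨h4, ?_⟩
    exact HasSum.mul (f := g 0) (g := fun k : Fin n → ℤ => ∏ j : Fin n, g j.succ (k j))
      (hg 0).of_norm.hasSum h2 h3

lemma ENNReal.tsum_prod_pi {n : ℕ} (g : Fin n → ℤ → ENNReal) :
    ∑' k : Fin n → ℤ, ∏ j, g j (k j) = ∏ j, ∑' m, g j m := by
  induction n with
  | zero => simp
  | succ n ih =>
    rw [← (Fin.consEquiv fun _ => ℤ).tsum_eq]
    simp only [Fin.consEquiv_apply, Fin.prod_univ_succ, Fin.cons_zero, Fin.cons_succ]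
    rw [ENNReal.tsum_prod (f := fun m (k : Fin n → ℤ) => g 0 m * ∏ j, g (Fin.succ j) (k j))]
    simp only [ENNReal.tsum_mul_left, ENNReal.tsum_mul_right, ih]

lemma hasSum_cFourierCoef {f : ℝ → ℂ} (hper : Function.Periodic f (2 * Real.pi))
    (hcont : Continuous f) (hs : Summable fun k => ‖cFourierCoef f k‖) (x : ℝ) :
    HasSum (fun k : ℤ => cFourierCoef f k * halfExp (2 * k) x) (f x) := by
  have : Fact (0 < 2 * Real.pi) := ⟨Real.two_pi_pos⟩
  let F : C(AddCircle (2 * Real.pi), ℂ) := ⟨hper.lift, continuous_quot_lift _ hcont⟩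
  have hexp : ∀ (k : ℤ) (y : ℝ),
      fourier k (y : AddCircle (2 * Real.pi)) = Complex.exp (Complex.I * k * y) := by
    intro k y
    rw [fourier_coe_apply]
    congr 1
    have : (Real.pi : ℂ) ≠ 0 := by exact_mod_cast Real.pi_ne_zero
    push_cast
    field_simp
  have hF : ∀ y : ℝ, F (y : AddCircle (2 * Real.pi)) = f y := fun y => hper.lift_coe y
  have hc : fourierCoeff F = cFourierCoef f := by
    funext k
    rw [fourierCoeff_eq_intervalIntegral _ k (-Real.pi), cFourierCoef,
      show -Real.pi + 2 * Real.pi = Real.pi by ring, Complex.real_smul]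
    push_cast
    congr 1
    refine intervalIntegral.integral_congr fun y _ => ?_
    simp only [hF, hexp, smul_eq_mul]
    push_cast
    rw [mul_comm]
    congr 2
    ring
  have h := has_pointwise_sum_fourier_series_of_summable (f := F) (hc ▸ hs.of_norm) x
  rw [hF, hc] at h
  convert h using 2 with k
  rw [smul_eq_mul, hexp]
  congr 1
  unfold halfExp
  congr 1
  push_cast
  ring

lemma integral_halfExp_mul_exp (p m : ℤ) :
    ∫ α in (-Real.pi)..Real.pi, halfExp (2 * p) α * Complex.exp (-Complex.I * m * α) =
      if p = m then 2 * Real.pi else 0 := by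
  have h : ∀ α : ℝ, halfExp (2 * p) α * Complex.exp (-Complex.I * m * α) =
      Complex.exp ((Complex.I * (p - m)) * α) := by
    intro α
    unfold halfExp
    rw [← Complex.exp_add]
    congr 1
    push_cast
    ring
  simp_rw [h]
  split_ifs with hpm
  · subst hpm
    simp
    ring
  · have hne : Complex.I * ((p : ℂ) - m) ≠ 0 :=
      mul_ne_zero Complex.I_ne_zero (sub_ne_zero.2 (by exact_mod_cast hpm))
    rw [integral_exp_mul_complex hne, Complex.ofReal_zero, div_eq_zero_iff, sub_eq_zero]
    left
    rw [Complex.exp_eq_exp_iff_exists_int]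
    exact ⟨p - m, by push_cast; ring⟩

lemma hasSum_cFourierCoef_of_hasSum {ι : Type*} [Countable ι] {F : ℝ → ℂ} {d : ι → ℂ} {p : ι → ℤ}
    (hd : Summable fun k => ‖d k‖) (hF : ∀ α, HasSum (fun k => d k * halfExp (2 * p k) α) (F α))
    (m : ℤ) : HasSum (fun k => if p k = m then d k else 0) (cFourierCoef F m) := by
  have h := intervalIntegral.hasSum_integral_of_dominated_convergence (μ := volume)
    (a := -Real.pi) (b := Real.pi)
    (F := fun k α => d k * halfExp (2 * p k) α * Complex.exp (-Complex.I * m * α))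
    (f := fun α => F α * Complex.exp (-Complex.I * m * α)) (fun k _ => ‖d k‖)
    (fun k => Continuous.aestronglyMeasurable
      ((continuous_const.mul (continuous_halfExp _)).mul (by fun_prop)))
    (fun k => ae_of_all _ fun α _ => ?_) (ae_of_all _ fun _ _ => hd)
    intervalIntegrable_const (ae_of_all _ fun α _ => (hF α).mul_right _)
  · have h' := h.mul_left (1 / (2 * Real.pi) : ℂ)
    have hk : ∀ k, 1 / (2 * Real.pi : ℂ) * ∫ α in (-Real.pi)..Real.pi,
        d k * halfExp (2 * p k) α * Complex.exp (-Complex.I * m * α) =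
          if p k = m then d k else 0 := by
      intro k
      simp_rw [mul_assoc (d k)]
      rw [intervalIntegral.integral_const_mul, integral_halfExp_mul_exp]
      have : (Real.pi : ℂ) ≠ 0 := by exact_mod_cast Real.pi_ne_zero
      split_ifs
      · push_cast
        field_simp
      · simp
    simpa only [hk, cFourierCoef] using h'
  · rw [norm_mul, norm_mul, norm_halfExp, mul_one, Complex.norm_exp]
    simp

lemma tsum_weight_cFourierCoef_le {ι : Type*} [Countable ι] {F : ℝ → ℂ} {d : ι → ℂ} {p : ι → ℤ}
    (hd : Summable fun k => ‖d k‖) (hF : ∀ α, HasSum (fun k => d k * halfExp (2 * p k) α) (F α))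
    (W : ℤ → ENNReal) :
    ∑' m, W m * ‖cFourierCoef F m‖ₑ ≤ ∑' k, W (p k) * ‖d k‖ₑ := by
  calc ∑' m, W m * ‖cFourierCoef F m‖ₑ
      ≤ ∑' m, ∑' k, if m = p k then W m * ‖d k‖ₑ else 0 := by
        refine ENNReal.tsum_le_tsum fun m => ?_
        rw [← (hasSum_cFourierCoef_of_hasSum hd hF m).tsum_eq]
        refine (mul_le_mul_right enorm_tsum_le_tsum_enorm _).trans_eq ?_
        rw [← ENNReal.tsum_mul_left]
        refine tsum_congr fun k => ?_
        simp only [eq_comm (a := m)]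
        split_ifs <;> simp
    _ = ∑' k, W (p k) * ‖d k‖ₑ := by
        rw [ENNReal.tsum_comm]
        exact tsum_congr fun k => tsum_ite_eq (p k) fun m => W m * ‖d k‖ₑ

lemma cWienerNorm_eq_tsum {s : ℝ} (hs : s ≠ 0) (ν t : ℝ) (f : ℝ → ℂ) :
    cWienerNorm ν t s f = ∑' k : ℤ,
      ENNReal.ofReal (Real.exp (ν * |(k : ℝ)| * t) * |(k : ℝ)| ^ s) * ‖cFourierCoef f k‖ₑ := by
  refine tsum_congr fun k => ?_
  rw [← ofReal_norm, ← ENNReal.ofReal_mul (by positivity)]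
  split_ifs with hk
  · simp [hk, Real.zero_rpow hs]
  · rfl

lemma cWienerNormF_zero_eq_tsum (ν t : ℝ) (f : ℝ → ℂ) :
    cWienerNormF ν t 0 f = ∑' k : ℤ,
      ENNReal.ofReal (Real.exp (ν * |(k : ℝ)| * t)) * ‖cFourierCoef f k‖ₑ := by
  rw [ENNReal.tsum_eq_add_tsum_ite 0, cWienerNormF, cWienerNorm]
  congr 1
  · simp
  · refine tsum_congr fun k => ?_
    split_ifs
    · rfl
    · rw [← ofReal_norm, ← ENNReal.ofReal_mul (by positivity), Real.rpow_zero, mul_one]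

lemma summable_mul_norm_cFourierCoef {ν t : ℝ} (hν : 0 ≤ ν) (ht : 0 ≤ t) {f : ℝ → ℂ}
    (h0 : cWienerNormF ν t 0 f ≠ ⊤) (h2 : cWienerNorm ν t 2 f ≠ ⊤) :
    Summable fun k : ℤ => (1 + |(k : ℝ)|) ^ 2 * ‖cFourierCoef f k‖ := by
  have key : ∀ {W : ℤ → ℝ}, (∀ k, 0 ≤ W k) →
      ∑' k : ℤ, ENNReal.ofReal (Real.exp (ν * |(k : ℝ)| * t) * W k) * ‖cFourierCoef f k‖ₑ ≠ ⊤ →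
      Summable fun k : ℤ => W k * ‖cFourierCoef f k‖ := by
    intro W hW h
    have hs := ENNReal.summable_toReal h
    refine hs.of_nonneg_of_le (fun k => mul_nonneg (hW k) (norm_nonneg _)) fun k => ?_
    rw [ENNReal.toReal_mul, toReal_enorm, ENNReal.toReal_ofReal
      (mul_nonneg (Real.exp_nonneg _) (hW k))]
    refine mul_le_mul_of_nonneg_right ?_ (norm_nonneg _)
    exact le_mul_of_one_le_left (hW k) (Real.one_le_exp (by positivity))
  rw [cWienerNormF_zero_eq_tsum] at h0
  rw [cWienerNorm_eq_tsum two_ne_zero] at h2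
  have s0 := key (W := fun _ => 1) (fun _ => zero_le_one) (by simpa using h0)
  have s2 := key (W := fun k => |(k : ℝ)| ^ (2 : ℝ)) (fun k => by positivity) h2
  refine ((s0.add s2).mul_left 2).of_nonneg_of_le (fun k => by positivity) fun k => ?_
  rw [Real.rpow_two]
  have : (1 + |(k : ℝ)|) ^ 2 ≤ 2 * (1 + |(k : ℝ)| ^ 2) := by nlinarith [sq_nonneg (1 - |(k : ℝ)|)]
  nlinarith [norm_nonneg (cFourierCoef f k)]

/-- The Fourier symbol in `β` of the `j`-th factor of `prodKer n l`. -/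
noncomputable def factorSymbol (l j : ℕ) (k : ℤ) (β : ℝ) : ℂ :=
  if j < l then halfExp (-2 * k) β else diffSymbol k β

/-- The size of `factorSymbol`: `1` for a translation, `|k|` for a difference quotient. -/
def factorSize (l j : ℕ) (k : ℤ) : ℕ := if j < l then 1 else k.natAbs

lemma isHalfTrigSum_factorSymbol (l j : ℕ) (k : ℤ) :
    IsHalfTrigSum (factorSize l j k) (2 * |(k : ℝ)|) (factorSymbol l j k) := by
  unfold factorSize
  split_ifs with h
  · have e : factorSymbol l j k = halfExp (-2 * k) := by funext β; simp [factorSymbol, h]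
    rw [e]
    simpa [abs_mul] using isHalfTrigSum_halfExp (-2 * k)
  · have e : factorSymbol l j k = diffSymbol k := by funext β; simp [factorSymbol, h]
    rw [e]
    exact isHalfTrigSum_diffSymbol k

lemma factorSize_le (l j : ℕ) (k : ℤ) : (factorSize l j k : ℝ) ≤ 1 + |(k : ℝ)| := by
  unfold factorSize
  split_ifs
  · simp
  · simp

lemma halfExp_sub_arg (k : ℤ) (α β : ℝ) :
    halfExp (2 * k) (α - β) = halfExp (2 * k) α * halfExp (-2 * k) β := by
  unfold halfExp
  rw [← Complex.exp_add]
  congr 1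
  push_cast
  ring

lemma hasSum_factor {f : ℝ → ℂ} (hper : Function.Periodic f (2 * Real.pi))
    (hcont : Continuous f) (hs : Summable fun k => ‖cFourierCoef f k‖) (l j : ℕ) (α β : ℝ) :
    HasSum (fun k : ℤ => cFourierCoef f k * halfExp (2 * k) α * factorSymbol l j k β)
      (if j < l then f (α - β) else deltaBeta f β α) := by
  have h1 := hasSum_cFourierCoef hper hcont hs (α - β)
  have h2 := hasSum_cFourierCoef hper hcont hs α
  simp_rw [halfExp_sub_arg] at h1
  unfold factorSymbol
  split_ifs
  · simpa only [mul_assoc] using h1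
  · unfold deltaBeta diffSymbol
    have h3 := (h1.sub h2).div_const ((2 * Real.sin (β / 2) : ℝ) : ℂ)
    have e : ∀ k : ℤ, cFourierCoef f k * halfExp (2 * k) α *
        ((halfExp (-2 * k) β - 1) / ((2 * Real.sin (β / 2) : ℝ) : ℂ)) =
        (cFourierCoef f k * (halfExp (2 * k) α * halfExp (-2 * k) β) -
          cFourierCoef f k * halfExp (2 * k) α) / ((2 * Real.sin (β / 2) : ℝ) : ℂ) := by
      intro k; ring
    simpa only [e] using h3

lemma prod_halfExp {n : ℕ} (k : Fin n → ℤ) (α : ℝ) :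
    ∏ j, halfExp (2 * k j) α = halfExp (2 * ∑ j, k j) α := by
  unfold halfExp
  rw [← Complex.exp_sum]
  congr 1
  rw [← Finset.mul_sum, ← Finset.sum_div, ← Finset.sum_mul]
  push_cast
  rw [Finset.mul_sum]

/-- Admissible weights: every half-frequency exponential has truncated integrals against
`w(β) / (2 sin (β/2))` that grow at most linearly, with principal value at most `4`. -/
def IsPVWeight (w : ℝ → ℂ) : Prop :=
  ∀ q : ℤ, HasPVBound (fun β => halfExp q β * w β) (Real.pi * (1 + |(q : ℝ)|)) 4

lemma IsPVWeight.hasPVBound_prod {w : ℝ → ℂ} (hw : IsPVWeight w) {n : ℕ} (l : ℕ)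
    (k : Fin n → ℤ) :
    HasPVBound (fun β => (∏ j : Fin n, factorSymbol l j (k j) β) * w β)
      ((∏ j : Fin n, (factorSize l j (k j) * (1 + 2 * |(k j : ℝ)|))) * Real.pi)
      ((∏ j : Fin n, (factorSize l j (k j) : ℝ)) * 4) := by
  have h := HasPVBound.halfTrigSum_prod_mul Finset.univ
    (fun j : Fin n => isHalfTrigSum_factorSymbol l j (k j)) (fun j => by positivity)
    Real.pi_pos.le hw 0
  simpa [halfExp] using h

lemma IsPVWeight.hasSum_arcIntegral {w : ℝ → ℂ} (hw : IsPVWeight w) {n : ℕ} (l : ℕ)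
    {f : Fin n → ℝ → ℂ} (hper : ∀ j, Function.Periodic (f j) (2 * Real.pi))
    (hcont : ∀ j, Continuous (f j))
    (hs : ∀ j, Summable fun k : ℤ => (1 + |(k : ℝ)|) ^ 2 * ‖cFourierCoef (f j) k‖) (α : ℝ)
    {ε : ℝ} (hε : 0 < ε) :
    HasSum (fun k : Fin n → ℤ => (∏ j, cFourierCoef (f j) (k j)) * halfExp (2 * ∑ j, k j) α *
        arcIntegral (fun β => (∏ j : Fin n, factorSymbol l j (k j) β) * w β) ε)
      (arcIntegral (fun β => prodKer n l f α β * w β) ε) := by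
  have hs0 : ∀ j, Summable fun k : ℤ => ‖cFourierCoef (f j) k‖ := fun j =>
    (hs j).of_nonneg_of_le (fun k => norm_nonneg _) fun k =>
      le_mul_of_one_le_left (norm_nonneg _) (one_le_pow₀ (by linarith [abs_nonneg (k : ℝ)]))
  have hsN : ∀ j : Fin n, Summable fun k : ℤ => ‖cFourierCoef (f j) k‖ * factorSize l j k :=
    fun j => (hs j).of_nonneg_of_le (fun k => by positivity) fun k => by
      rw [mul_comm]
      refine mul_le_mul_of_nonneg_right ((factorSize_le l j k).trans ?_) (norm_nonneg _)
      nlinarith [abs_nonneg (k : ℝ)]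
  have hb : Summable fun k : Fin n → ℤ =>
      ∏ j, (‖cFourierCoef (f j) (k j)‖ * factorSize l j (k j)) :=
    (Summable.prod_pi (g := fun (j : Fin n) (m : ℤ) =>
      ‖cFourierCoef (f j) m‖ * (factorSize l j m : ℝ)) fun j => (hsN j).norm).2.summable
  have hwc : ContinuousOn w {β | Real.sin (β / 2) ≠ 0} := by
    simpa [halfExp] using (hw 0).continuousOn
  have hw_int := integrableOn_puncturedArc hε (continuousOn_div_sin hwc)
  have key := hasSum_integral_of_dominated_convergence
    (μ := volume.restrict (puncturedArc ε))
    (F := fun (k : Fin n → ℤ) β => (∏ j, cFourierCoef (f j) (k j)) * halfExp (2 * ∑ j, k j) α *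
      ((∏ j : Fin n, factorSymbol l j (k j) β) * w β / ((2 * Real.sin (β / 2) : ℝ) : ℂ)))
    (f := fun β => prodKer n l f α β * w β / ((2 * Real.sin (β / 2) : ℝ) : ℂ))
    (fun k β => (∏ j, (‖cFourierCoef (f j) (k j)‖ * factorSize l j (k j))) *
      ‖w β / ((2 * Real.sin (β / 2) : ℝ) : ℂ)‖)
    (fun k => ?_) (fun k => ?_) (ae_of_all _ fun β => hb.mul_right _) ?_ ?_
  · unfold arcIntegral
    simpa only [integral_const_mul] using key
  · exact ((integrableOn_puncturedArc hε (continuousOn_div_sin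
      (hw.hasPVBound_prod l k).continuousOn)).const_mul _).aestronglyMeasurable
  · filter_upwards [ae_restrict_mem (measurableSet_puncturedArc ε)] with β hβ
    have hβ' := sin_half_ne_zero_of_mem hε hβ
    rw [norm_mul, norm_mul, norm_halfExp, mul_one, mul_div_assoc, norm_mul, ← mul_assoc,
      norm_prod, norm_prod, ← Finset.prod_mul_distrib]
    refine mul_le_mul_of_nonneg_right ?_ (norm_nonneg _)
    refine Finset.prod_le_prod (fun j _ => by positivity) fun j _ => ?_
    exact mul_le_mul_of_nonneg_left ((isHalfTrigSum_factorSymbol l j (k j)).norm_le hβ')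
      (norm_nonneg _)
  · simp_rw [tsum_mul_right]
    exact hw_int.norm.const_mul _
  · filter_upwards [ae_restrict_mem (measurableSet_puncturedArc ε)] with β hβ
    have hβ' := sin_half_ne_zero_of_mem hε hβ
    have h1 := (Summable.prod_pi (g := fun (j : Fin n) (m : ℤ) =>
      cFourierCoef (f j) m * halfExp (2 * m) α * factorSymbol l j m β) fun j =>
        (hsN j).of_nonneg_of_le (fun _ => norm_nonneg _) fun m => by
          rw [norm_mul, norm_mul, norm_halfExp, mul_one]
          exact mul_le_mul_of_nonneg_left ((isHalfTrigSum_factorSymbol l j m).norm_le hβ')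
            (norm_nonneg _)).2
    simp_rw [fun j : Fin n => (hasSum_factor (hper j) (hcont j) (hs0 j) l j α β).tsum_eq,
      Finset.prod_mul_distrib, prod_halfExp] at h1
    have h2 := h1.mul_right (w β / ((2 * Real.sin (β / 2) : ℝ) : ℂ))
    simpa only [prodKer, mul_assoc, mul_div_assoc] using h2

/-- A principal value integral of `prodKer` has an absolutely convergent trigonometric expansion
indexed by the frequencies of its factors. -/
lemma IsPVWeight.exists_hasSum {w : ℝ → ℂ} (hw : IsPVWeight w) {n : ℕ} (l : ℕ)
    {f : Fin n → ℝ → ℂ} (hper : ∀ j, Function.Periodic (f j) (2 * Real.pi))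
    (hcont : ∀ j, Continuous (f j))
    (hs : ∀ j, Summable fun k : ℤ => (1 + |(k : ℝ)|) ^ 2 * ‖cFourierCoef (f j) k‖)
    {F : ℝ → ℂ} (hF : ∀ α, Tendsto (arcIntegral fun β => prodKer n l f α β * w β)
      (nhdsWithin 0 (Set.Ioi 0)) (nhds (F α))) :
    ∃ d : (Fin n → ℤ) → ℂ,
      (∀ k, ‖d k‖ ≤ 4 * ∏ j, (‖cFourierCoef (f j) (k j)‖ * factorSize l j (k j))) ∧
      (Summable fun k => ‖d k‖) ∧
      ∀ α, HasSum (fun k => d k * halfExp (2 * ∑ j, k j) α) (F α) := by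
  choose z hz hl using fun k : Fin n → ℤ => (hw.hasPVBound_prod l k).exists_lim
  have hbd : ∀ k : Fin n → ℤ, ‖(∏ j, cFourierCoef (f j) (k j)) * z k‖ ≤
      4 * ∏ j, (‖cFourierCoef (f j) (k j)‖ * factorSize l j (k j)) := by
    intro k
    rw [norm_mul, norm_prod, Finset.prod_mul_distrib]
    calc _ ≤ (∏ j, ‖cFourierCoef (f j) (k j)‖) * ((∏ j : Fin n, (factorSize l j (k j) : ℝ)) * 4) :=
          mul_le_mul_of_nonneg_left (hz k) (Finset.prod_nonneg fun _ _ => norm_nonneg _)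
      _ = _ := by ring
  have hsM : ∀ j : Fin n, Summable fun m : ℤ =>
      ‖cFourierCoef (f j) m‖ * (factorSize l j m * (1 + 2 * |(m : ℝ)|)) := fun j =>
    ((hs j).mul_left 2).of_nonneg_of_le (fun m => by positivity) fun m => by
      have h1 := factorSize_le l j m
      have h2 : (factorSize l j m : ℝ) * (1 + 2 * |(m : ℝ)|) ≤
          (1 + |(m : ℝ)|) * (2 * (1 + |(m : ℝ)|)) :=
        mul_le_mul h1 (by linarith) (by positivity) (by positivity)
      nlinarith [norm_nonneg (cFourierCoef (f j) m)]
  have hB : Summable fun k : Fin n → ℤ =>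
      ∏ j, (‖cFourierCoef (f j) (k j)‖ * (factorSize l j (k j) * (1 + 2 * |(k j : ℝ)|))) :=
    (Summable.prod_pi (g := fun (j : Fin n) (m : ℤ) =>
      ‖cFourierCoef (f j) m‖ * (factorSize l j m * (1 + 2 * |(m : ℝ)|)))
      fun j => (hsM j).norm).2.summable
  have hd : Summable fun k => ‖(∏ j, cFourierCoef (f j) (k j)) * z k‖ := by
    refine (hB.mul_left 4).of_nonneg_of_le (fun _ => norm_nonneg _) fun k => (hbd k).trans ?_
    refine mul_le_mul_of_nonneg_left ?_ (by norm_num)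
    refine Finset.prod_le_prod (fun j _ => by positivity) fun j _ => ?_
    refine mul_le_mul_of_nonneg_left ?_ (norm_nonneg _)
    exact le_mul_of_one_le_right (Nat.cast_nonneg _) (by linarith [abs_nonneg (k j : ℝ)])
  refine ⟨_, hbd, hd, fun α => ?_⟩
  have hlim := tendsto_tsum_of_dominated_convergence (𝓕 := nhdsWithin (0 : ℝ) (Set.Ioi 0))
    (f := fun ε (k : Fin n → ℤ) => (∏ j, cFourierCoef (f j) (k j)) * halfExp (2 * ∑ j, k j) α *
        arcIntegral (fun β => (∏ j : Fin n, factorSymbol l j (k j) β) * w β) ε)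
    (g := fun k => (∏ j, cFourierCoef (f j) (k j)) * halfExp (2 * ∑ j, k j) α * z k)
    (hB.mul_right Real.pi) (fun k => (hl k).const_mul _) ?_
  · have hlim' : Tendsto (arcIntegral fun β => prodKer n l f α β * w β)
        (nhdsWithin 0 (Set.Ioi 0)) (nhds
          (∑' k, (∏ j, cFourierCoef (f j) (k j)) * halfExp (2 * ∑ j, k j) α * z k)) := by
      refine hlim.congr' ?_
      filter_upwards [self_mem_nhdsWithin] with ε hε
      exact (hw.hasSum_arcIntegral l hper hcont hs α hε).tsum_eq
    rw [tendsto_nhds_unique (hF α) hlim']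
    have hsum : Summable fun k =>
        (∏ j, cFourierCoef (f j) (k j)) * halfExp (2 * ∑ j, k j) α * z k := by
      refine hd.of_norm_bounded fun k => ?_
      simp only [norm_mul, norm_halfExp, mul_one, le_refl]
    simpa only [mul_right_comm] using hsum.hasSum
  · filter_upwards [Ioc_mem_nhdsGT Real.pi_pos] with ε hε k
    rw [norm_mul, norm_mul, norm_halfExp, mul_one, norm_prod, Finset.prod_mul_distrib, mul_assoc]
    exact mul_le_mul_of_nonneg_left ((hw.hasPVBound_prod l k).norm_le ε hε.1 hε.2)
      (Finset.prod_nonneg fun _ _ => norm_nonneg _)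

lemma abs_sum_rpow_le {ι : Type*} (S : Finset ι) (x : ι → ℝ) {s : ℝ} (hs : 0 < s) (hs1 : s ≤ 1) :
    |∑ i ∈ S, x i| ^ s ≤ ∑ i ∈ S, |x i| ^ s := by
  classical
  induction S using Finset.induction_on with
  | empty => simp [Real.zero_rpow hs.ne']
  | insert i S hi ih =>
    rw [Finset.sum_insert hi, Finset.sum_insert hi]
    refine (Real.rpow_le_rpow (abs_nonneg _) (abs_add_le _ _) hs.le).trans ?_
    refine (Real.rpow_add_le_add_rpow (abs_nonneg _) (abs_nonneg _) hs.le hs1).trans ?_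
    linarith

lemma ofReal_exp_abs_sum_le {n : ℕ} {ν t : ℝ} (hν : 0 ≤ ν) (ht : 0 ≤ t) (k : Fin n → ℤ) :
    ENNReal.ofReal (Real.exp (ν * |((∑ j, k j : ℤ) : ℝ)| * t)) ≤
      ∏ j, ENNReal.ofReal (Real.exp (ν * |(k j : ℝ)| * t)) := by
  rw [← ENNReal.ofReal_prod_of_nonneg fun _ _ => (Real.exp_pos _).le, ← Real.exp_sum,
    ← Finset.sum_mul, ← Finset.mul_sum]
  push_cast
  gcongr
  exact Finset.abs_sum_le_sum_abs _ _

/-- The summand of the weighted Wiener norm attached to the `j`-th factor of `prodKer n l`. -/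
noncomputable def factorTerm (l : ℕ) (ν t : ℝ) (f : ℝ → ℂ) (j : ℕ) (m : ℤ) : ENNReal :=
  ENNReal.ofReal (Real.exp (ν * |(m : ℝ)| * t)) * (‖cFourierCoef f m‖ₑ * factorSize l j m)

lemma natCast_natAbs_eq_ofReal (m : ℤ) : (m.natAbs : ENNReal) = ENNReal.ofReal |(m : ℝ)| := by
  rw [← Int.cast_abs, Int.abs_eq_natAbs, Int.cast_natCast, ENNReal.ofReal_natCast]

lemma tsum_factorTerm (l : ℕ) (ν t : ℝ) (f : ℝ → ℂ) (j : ℕ) :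
    ∑' m, factorTerm l ν t f j m =
      if j < l then cWienerNormF ν t 0 f else cWienerNorm ν t 1 f := by
  unfold factorTerm factorSize
  split_ifs
  · rw [cWienerNormF_zero_eq_tsum]
    simp
  · rw [cWienerNorm_eq_tsum one_ne_zero]
    refine tsum_congr fun m => ?_
    rw [Real.rpow_one, natCast_natAbs_eq_ofReal, ENNReal.ofReal_mul (Real.exp_pos _).le]
    ring

lemma tsum_rpow_mul_factorTerm (l : ℕ) (ν t : ℝ) (f : ℝ → ℂ) (j : ℕ) {s : ℝ} (hs : 0 < s) :
    ∑' m : ℤ, ENNReal.ofReal (|(m : ℝ)| ^ s) * factorTerm l ν t f j m =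
      if j < l then cWienerNorm ν t s f else cWienerNorm ν t (s + 1) f := by
  unfold factorTerm factorSize
  split_ifs
  · rw [cWienerNorm_eq_tsum hs.ne']
    refine tsum_congr fun m => ?_
    rw [ENNReal.ofReal_mul (Real.exp_pos _).le]
    push_cast
    ring
  · rw [cWienerNorm_eq_tsum (by positivity)]
    refine tsum_congr fun m => ?_
    have h : |(m : ℝ)| ^ (s + 1) = |(m : ℝ)| ^ s * |(m : ℝ)| := by
      rw [Real.rpow_add_of_nonneg (abs_nonneg _) hs.le zero_le_one, Real.rpow_one]
    rw [h, natCast_natAbs_eq_ofReal, ENNReal.ofReal_mul (Real.exp_pos _).le,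
      ENNReal.ofReal_mul (by positivity)]
    ring

lemma exp_mul_enorm_le {n l : ℕ} {ν t : ℝ} (hν : 0 ≤ ν) (ht : 0 ≤ t) {f : Fin n → ℝ → ℂ} {z : ℂ}
    (k : Fin n → ℤ)
    (hz : ‖z‖ ≤ 4 * ∏ j, (‖cFourierCoef (f j) (k j)‖ * factorSize l j (k j))) :
    ENNReal.ofReal (Real.exp (ν * |((∑ j, k j : ℤ) : ℝ)| * t)) * ‖z‖ₑ ≤
      ENNReal.ofReal 4 * ∏ j : Fin n, factorTerm l ν t (f j) j (k j) := by
  have h : ‖z‖ₑ ≤ ENNReal.ofReal 4 *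
      ∏ j : Fin n, (‖cFourierCoef (f j) (k j)‖ₑ * factorSize l j (k j)) := by
    rw [← ofReal_norm]
    refine (ENNReal.ofReal_le_ofReal hz).trans_eq ?_
    rw [ENNReal.ofReal_mul (by norm_num), ENNReal.ofReal_prod_of_nonneg fun _ _ => by positivity]
    congr 1
    refine Finset.prod_congr rfl fun j _ => ?_
    rw [ENNReal.ofReal_mul (norm_nonneg _), ofReal_norm, ENNReal.ofReal_natCast]
  refine (mul_le_mul' (ofReal_exp_abs_sum_le hν ht k) h).trans_eq ?_
  unfold factorTerm
  rw [Finset.prod_mul_distrib (f := fun j : Fin n => ENNReal.ofReal _)]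
  ring

lemma prod_ite_lt_eq {n : ℕ} (l : ℕ) (S : Finset (Fin n)) (P Q : Fin n → ENNReal) :
    ∏ j ∈ S, (if (j : ℕ) < l then P j else Q j) =
      (∏ j ∈ S.filter (fun j : Fin n => (j : ℕ) < l), P j) *
        ∏ j ∈ S.filter (fun j : Fin n => ¬ (j : ℕ) < l), Q j :=
  Finset.prod_ite _ _

lemma cWienerNormF_zero_le_of_hasSum {n l : ℕ} {ν t : ℝ} (hν : 0 ≤ ν) (ht : 0 ≤ t)
    {f : Fin n → ℝ → ℂ} {F : ℝ → ℂ} {d : (Fin n → ℤ) → ℂ}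
    (hd : ∀ k, ‖d k‖ ≤ 4 * ∏ j, (‖cFourierCoef (f j) (k j)‖ * factorSize l j (k j)))
    (hds : Summable fun k => ‖d k‖)
    (hF : ∀ α, HasSum (fun k => d k * halfExp (2 * ∑ j, k j) α) (F α)) :
    cWienerNormF ν t 0 F ≤ nonlinearRHS0 n l f ν t := by
  rw [cWienerNormF_zero_eq_tsum]
  refine (tsum_weight_cFourierCoef_le hds hF
    fun m => ENNReal.ofReal (Real.exp (ν * |(m : ℝ)| * t))).trans ?_
  refine (ENNReal.tsum_le_tsum fun k => exp_mul_enorm_le hν ht k (hd k)).trans_eq ?_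
  rw [ENNReal.tsum_mul_left,
    ENNReal.tsum_prod_pi fun (j : Fin n) (m : ℤ) => factorTerm l ν t (f j) j m]
  simp_rw [tsum_factorTerm]
  rw [prod_ite_lt_eq, nonlinearRHS0]

lemma prod_tsum_factorTerm_eq {n : ℕ} (l : ℕ) (ν t : ℝ) (f : Fin n → ℝ → ℂ) {s : ℝ}
    (hs : 0 < s) (i : Fin n) :
    ∑' k : Fin n → ℤ, ENNReal.ofReal (|(k i : ℝ)| ^ s) *
        ∏ j : Fin n, factorTerm l ν t (f j) j (k j) =
      (if (i : ℕ) < l then cWienerNorm ν t s (f i) else cWienerNorm ν t (s + 1) (f i)) *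
        (∏ j ∈ Finset.univ.filter (fun j : Fin n => (j : ℕ) < l ∧ j ≠ i),
            cWienerNormF ν t 0 (f j)) *
          ∏ j ∈ Finset.univ.filter (fun j : Fin n => ¬ (j : ℕ) < l ∧ j ≠ i),
            cWienerNorm ν t 1 (f j) := by
  have h : ∀ k : Fin n → ℤ, ENNReal.ofReal (|(k i : ℝ)| ^ s) *
        ∏ j : Fin n, factorTerm l ν t (f j) j (k j) =
      ∏ j : Fin n, ((if j = i then ENNReal.ofReal (|(k j : ℝ)| ^ s) else 1) *
        factorTerm l ν t (f j) j (k j)) := by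
    intro k
    rw [Finset.prod_mul_distrib, Finset.prod_ite_eq' Finset.univ i]
    simp
  simp_rw [h]
  rw [ENNReal.tsum_prod_pi fun (j : Fin n) (m : ℤ) =>
    (if j = i then ENNReal.ofReal (|(m : ℝ)| ^ s) else 1) * factorTerm l ν t (f j) j m]
  rw [← Finset.mul_prod_erase _ _ (Finset.mem_univ i)]
  simp only [if_true, tsum_rpow_mul_factorTerm l ν t _ _ hs]
  have h2 : ∏ j ∈ Finset.univ.erase i, ∑' m : ℤ,
      (if j = i then ENNReal.ofReal (|(m : ℝ)| ^ s) else 1) * factorTerm l ν t (f j) j m =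
      ∏ j ∈ Finset.univ.erase i,
        if (j : ℕ) < l then cWienerNormF ν t 0 (f j) else cWienerNorm ν t 1 (f j) := by
    refine Finset.prod_congr rfl fun j hj => ?_
    simp only [Finset.ne_of_mem_erase hj, if_false, one_mul, tsum_factorTerm]
  rw [h2, prod_ite_lt_eq, mul_assoc]
  congr 3 <;> ext j <;> simp [and_comm]

lemma cWienerNorm_le_of_hasSum {n l : ℕ} {ν t : ℝ} (hν : 0 ≤ ν) (ht : 0 ≤ t)
    {f : Fin n → ℝ → ℂ} {F : ℝ → ℂ} {d : (Fin n → ℤ) → ℂ}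
    (hd : ∀ k, ‖d k‖ ≤ 4 * ∏ j, (‖cFourierCoef (f j) (k j)‖ * factorSize l j (k j)))
    (hds : Summable fun k => ‖d k‖)
    (hF : ∀ α, HasSum (fun k => d k * halfExp (2 * ∑ j, k j) α) (F α))
    {s : ℝ} (hs : 0 < s) (hs1 : s ≤ 1) :
    cWienerNorm ν t s F ≤ nonlinearRHS n l f ν t s := by
  rw [cWienerNorm_eq_tsum hs.ne']
  refine (tsum_weight_cFourierCoef_le hds hF
    fun m => ENNReal.ofReal (Real.exp (ν * |(m : ℝ)| * t) * |(m : ℝ)| ^ s)).trans ?_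
  have hk : ∀ k : Fin n → ℤ,
      ENNReal.ofReal (Real.exp (ν * |((∑ j, k j : ℤ) : ℝ)| * t) *
        |((∑ j, k j : ℤ) : ℝ)| ^ s) * ‖d k‖ₑ ≤
      ENNReal.ofReal 4 * ∑ i, ENNReal.ofReal (|(k i : ℝ)| ^ s) *
        ∏ j : Fin n, factorTerm l ν t (f j) j (k j) := by
    intro k
    have h1 : ENNReal.ofReal (|((∑ j, k j : ℤ) : ℝ)| ^ s) ≤
        ∑ i, ENNReal.ofReal (|(k i : ℝ)| ^ s) := by
      rw [← ENNReal.ofReal_sum_of_nonneg fun _ _ => by positivity]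
      refine ENNReal.ofReal_le_ofReal ?_
      push_cast
      exact abs_sum_rpow_le _ _ hs hs1
    rw [ENNReal.ofReal_mul (Real.exp_pos _).le, mul_right_comm]
    refine (mul_le_mul' (exp_mul_enorm_le hν ht k (hd k)) h1).trans_eq ?_
    rw [← Finset.sum_mul]
    ring
  refine (ENNReal.tsum_le_tsum hk).trans_eq ?_
  rw [ENNReal.tsum_mul_left, Summable.tsum_finsetSum fun _ _ => ENNReal.summable]
  simp_rw [prod_tsum_factorTerm_eq l ν t f hs]
  rw [nonlinearRHS, ← Finset.sum_filter_add_sum_filter_not Finset.univ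
    (fun j : Fin n => (j : ℕ) < l)]
  congr 2
  · refine Finset.sum_congr rfl fun i hi => ?_
    have hi' := (Finset.mem_filter.1 hi).2
    rw [if_pos hi']
    congr 2
    ext j
    simp only [Finset.mem_filter, Finset.mem_univ, true_and, and_iff_left_iff_imp]
    rintro hj rfl
    exact hj hi'
  · refine Finset.sum_congr rfl fun i hi => ?_
    have hi' := (Finset.mem_filter.1 hi).2
    rw [if_neg hi']
    congr 3
    ext j
    simp only [Finset.mem_filter, Finset.mem_univ, true_and, and_iff_left_iff_imp]
    rintro hj rfl
    exact hi' hj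

lemma isPVWeight_one : IsPVWeight fun _ => 1 := hasPVBound_halfExp_mul_one

lemma isPVWeight_cos : IsPVWeight fun β => (Real.cos (β / 2) : ℂ) := hasPVBound_halfExp_mul_cos

lemma continuousOn_prodKer {n : ℕ} (l : ℕ) {f : Fin n → ℝ → ℂ} (hcont : ∀ j, Continuous (f j))
    (α : ℝ) : ContinuousOn (prodKer n l f α) {β | Real.sin (β / 2) ≠ 0} := by
  unfold prodKer
  refine continuousOn_finsetProd _ fun j _ => ?_
  have hc : Continuous fun β => f j (α - β) := (hcont j).comp (by fun_prop)
  split_ifs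
  · exact hc.continuousOn
  · exact continuousOn_div_sin (hc.sub continuous_const).continuousOn

lemma arcIntegral_eq_pvSinApprox {n : ℕ} (l : ℕ) {f : Fin n → ℝ → ℂ}
    (hcont : ∀ j, Continuous (f j)) (α : ℝ) {ε : ℝ} (hε : 0 < ε) (hεπ : ε ≤ Real.pi) :
    arcIntegral (fun β => prodKer n l f α β * 1) ε = pvSinApprox n l f α ε := by
  simp only [mul_one]
  exact setIntegral_puncturedArc hε hεπ (continuousOn_div_sin (continuousOn_prodKer l hcont α))

lemma arcIntegral_eq_pvTanApprox {n : ℕ} (l : ℕ) {f : Fin n → ℝ → ℂ}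
    (hcont : ∀ j, Continuous (f j)) (α : ℝ) {ε : ℝ} (hε : 0 < ε) (hεπ : ε ≤ Real.pi) :
    arcIntegral (fun β => prodKer n l f α β * (Real.cos (β / 2) : ℂ)) ε =
      pvTanApprox n l f α ε := by
  have h : ∀ β : ℝ, prodKer n l f α β * (Real.cos (β / 2) : ℂ) /
      ((2 * Real.sin (β / 2) : ℝ) : ℂ) =
      prodKer n l f α β / ((2 * Real.tan (β / 2) : ℝ) : ℂ) := by
    intro β
    rw [Real.tan_eq_sin_div_cos, ← mul_div_assoc, Complex.ofReal_div, div_div_eq_mul_div]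
  have hc : Continuous fun β : ℝ => (Real.cos (β / 2) : ℂ) := by fun_prop
  have hg : ContinuousOn (fun β => prodKer n l f α β * (Real.cos (β / 2) : ℂ))
      {β | Real.sin (β / 2) ≠ 0} := (continuousOn_prodKer l hcont α).mul hc.continuousOn
  rw [arcIntegral, setIntegral_puncturedArc hε hεπ (continuousOn_div_sin hg)]
  simp_rw [h]
  rfl

/-- Lemma 3.3 (nonlinear estimate): the Wiener norms of the principal value
integrals `I` and `J` are controlled by products of Wiener norms of the `f_j`. -/
theorem nonlinear_wiener_estimate (n l : ℕ) (hl : l ≤ n) (ν t : ℝ) (hν : 0 ≤ ν) (ht : 0 ≤ t)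
    (f : Fin n → ℝ → ℂ) (hper : ∀ j, Function.Periodic (f j) (2 * Real.pi))
    (hcont : ∀ j, Continuous (f j))
    (hnorm0 : ∀ j, cWienerNormF ν t 0 (f j) ≠ ⊤)
    (hnorm2 : ∀ j, cWienerNorm ν t 2 (f j) ≠ ⊤) :
    (∀ I : ℝ → ℂ, (∀ α : ℝ, Tendsto (fun ε => pvSinApprox n l f α ε)
        (nhdsWithin 0 (Set.Ioi 0)) (nhds (I α))) →
      (∀ s : ℝ, 0 < s → s ≤ 1 → cWienerNorm ν t s I ≤ nonlinearRHS n l f ν t s) ∧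
        cWienerNormF ν t 0 I ≤ nonlinearRHS0 n l f ν t) ∧
    (∀ J : ℝ → ℂ, (∀ α : ℝ, Tendsto (fun ε => pvTanApprox n l f α ε)
        (nhdsWithin 0 (Set.Ioi 0)) (nhds (J α))) →
      (∀ s : ℝ, 0 < s → s ≤ 1 → cWienerNorm ν t s J ≤ nonlinearRHS n l f ν t s) ∧
        cWienerNormF ν t 0 J ≤ nonlinearRHS0 n l f ν t) := by
  have hs := fun j => summable_mul_norm_cFourierCoef hν ht (hnorm0 j) (hnorm2 j)
  have main : ∀ {w : ℝ → ℂ} {F : ℝ → ℂ} {A : ℝ → ℝ → ℂ}, IsPVWeight w →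
      (∀ α ε, 0 < ε → ε ≤ Real.pi →
        arcIntegral (fun β => prodKer n l f α β * w β) ε = A α ε) →
      (∀ α, Tendsto (A α) (nhdsWithin 0 (Set.Ioi 0)) (nhds (F α))) →
      (∀ s : ℝ, 0 < s → s ≤ 1 → cWienerNorm ν t s F ≤ nonlinearRHS n l f ν t s) ∧
        cWienerNormF ν t 0 F ≤ nonlinearRHS0 n l f ν t := by
    intro w F A hw hA hF
    obtain ⟨d, hd, hds, hdF⟩ := hw.exists_hasSum l hper hcont hs (F := F) fun α => by
      refine (hF α).congr' ?_
      filter_upwards [Ioc_mem_nhdsGT Real.pi_pos] with ε hε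
      exact (hA α ε hε.1 hε.2).symm
    exact ⟨fun s h0 h1 => cWienerNorm_le_of_hasSum hν ht hd hds hdF h0 h1,
      cWienerNormF_zero_le_of_hasSum hν ht hd hds hdF⟩
  exact ⟨fun _ => main isPVWeight_one fun α _ => arcIntegral_eq_pvSinApprox l hcont α,
    fun _ => main isPVWeight_cos fun α _ => arcIntegral_eq_pvTanApprox l hcont α⟩
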